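/- Let m be a positive integer and ξ a U_m-number. Then ŵ_m(ξ) = m. -/

import Mathlib

open Polynomial Filter

/-- Height of an integer polynomial: the maximum absolute value of its coefficients. -/
noncomputable def polyHeight (P : Polynomial ℤ) : ℝ :=
  ((P.support.sup fun i => (P.coeff i).natAbs : ℕ) : ℝ)

/-- `P` and `Q` have no common non-constant factor in `ℤ[X]`. -/
def CoprimePoly (P Q : Polynomial ℤ) : Prop :=
  ∀ d : Polynomial ℤ, d ∣ P → d ∣ Q → d.natDegree = 0

/-- The exponent `w_n(ξ)`. -/
noncomputable def wExp (n : ℕ) (ξ : ℝ) : EReal :=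
  sSup {x : EReal | ∃ w : ℝ, x = (w : EReal) ∧
    {P : Polynomial ℤ | P.natDegree ≤ n ∧ 0 < |Polynomial.aeval ξ P| ∧
      |Polynomial.aeval ξ P| ≤ (polyHeight P) ^ (-w)}.Infinite}

/-- The uniform exponent `ŵ_n(ξ)`. -/
noncomputable def whExp (n : ℕ) (ξ : ℝ) : EReal :=
  sSup {x : EReal | ∃ w : ℝ, x = (w : EReal) ∧
    ∀ᶠ H : ℝ in atTop, ∃ P : Polynomial ℤ, P.natDegree ≤ n ∧ polyHeight P ≤ H ∧
      0 < |Polynomial.aeval ξ P| ∧ |Polynomial.aeval ξ P| ≤ H ^ (-w)}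

/-- The exponent `w*_n(ξ)` of approximation by algebraic numbers of degree at most `n`;
the height of an algebraic number is the height of its irreducible defining polynomial. -/
noncomputable def wStarExp (n : ℕ) (ξ : ℝ) : EReal :=
  sSup {x : EReal | ∃ w : ℝ, x = (w : EReal) ∧
    {α : ℝ | ∃ P : Polynomial ℤ, Irreducible P ∧ Polynomial.aeval α P = 0 ∧
      P.natDegree ≤ n ∧ 0 < |ξ - α| ∧ |ξ - α| ≤ (polyHeight P) ^ (-w - 1)}.Infinite}

/-- The uniform exponent `ŵ*_n(ξ)`. -/
noncomputable def whStarExp (n : ℕ) (ξ : ℝ) : EReal :=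
  sSup {x : EReal | ∃ w : ℝ, x = (w : EReal) ∧
    ∀ᶠ H : ℝ in atTop, ∃ α : ℝ, ∃ P : Polynomial ℤ, Irreducible P ∧
      Polynomial.aeval α P = 0 ∧ P.natDegree ≤ n ∧ polyHeight P ≤ H ∧
      0 < |ξ - α| ∧ |ξ - α| ≤ (polyHeight P)⁻¹ * H ^ (-w)}

theorem polyHeight_le_iff {P : ℤ[X]} {B : ℝ} (hB : 0 ≤ B) :
    polyHeight P ≤ B ↔ ∀ i, |(P.coeff i : ℝ)| ≤ B := by
  rw [polyHeight, ← Nat.le_floor_iff hB, Finset.sup_le_iff]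
  constructor
  · intro h i
    by_cases hi : i ∈ P.support
    · have := (Nat.le_floor_iff hB).1 (h i hi)
      rwa [Nat.cast_natAbs, Int.cast_abs] at this
    · simpa [notMem_support_iff.1 hi] using hB
  · intro h i _
    rw [Nat.le_floor_iff hB, Nat.cast_natAbs, Int.cast_abs]
    exact h i

theorem polyHeight_nonneg (P : ℤ[X]) : 0 ≤ polyHeight P := Nat.cast_nonneg _

theorem abs_coeff_le_polyHeight (P : ℤ[X]) (i : ℕ) : |(P.coeff i : ℝ)| ≤ polyHeight P :=
  (polyHeight_le_iff (polyHeight_nonneg P)).1 le_rfl i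

theorem one_le_polyHeight {P : ℤ[X]} (hP : P ≠ 0) : 1 ≤ polyHeight P := by
  refine le_trans ?_ (abs_coeff_le_polyHeight P P.natDegree)
  exact_mod_cast Int.one_le_abs (leadingCoeff_ne_zero.2 hP)

theorem mahlerMeasure_le_polyHeight {P : ℤ[X]} {m : ℕ} (hm : P.natDegree ≤ m) :
    (P.map (Int.castRingHom ℂ)).mahlerMeasure ≤ (m + 1) * polyHeight P := by
  refine (mahlerMeasure_le_sum_norm_coeff _).trans ?_
  rw [sum_over_range' _ (by simp) (m + 1)
    (Nat.lt_succ_of_le (natDegree_map_le.trans hm))]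
  refine (Finset.sum_le_card_nsmul _ _ (polyHeight P) fun i _ => ?_).trans (by simp)
  simpa using abs_coeff_le_polyHeight P i

theorem finite_polyHeight_le (m : ℕ) (B : ℝ) :
    {P : ℤ[X] | P.natDegree ≤ m ∧ polyHeight P ≤ B}.Finite := by
  refine (finite_mahlerMeasure_le m ((m + 1) * B).toNNReal).subset fun P hP => ⟨hP.1, ?_⟩
  refine (mahlerMeasure_le_polyHeight hP.1).trans (le_trans ?_ (Real.le_coe_toNNReal _))
  exact mul_le_mul_of_nonneg_left hP.2 (by positivity)

/-- Weak form of Gelfond's lemma. -/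
theorem polyHeight_left_le_of_mul {A B : ℤ[X]} {m : ℕ} (hAB : A * B ≠ 0)
    (hm : (A * B).natDegree ≤ m) :
    polyHeight A ≤ 2 ^ m * (m + 1) * polyHeight (A * B) := by
  have hA := left_ne_zero_of_mul hAB
  have hB := right_ne_zero_of_mul hAB
  have hdeg : A.natDegree ≤ m := by
    rw [natDegree_mul hA hB] at hm
    lia
  have h0 := polyHeight_nonneg (A * B)
  rw [polyHeight_le_iff (by positivity)]
  intro i
  have h1 := norm_coeff_le_choose_mul_mahlerMeasure_of_one_le_mahlerMeasure i
    (A.map (Int.castRingHom ℂ)) (B.map (Int.castRingHom ℂ))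
    (one_le_mahlerMeasure_of_ne_zero hB)
  rw [← Polynomial.map_mul] at h1
  have h2 := mahlerMeasure_le_polyHeight hm
  have h3 : (((A.map (Int.castRingHom ℂ)).natDegree.choose i : ℕ) : ℝ) ≤ 2 ^ m := by
    have : (A.map (Int.castRingHom ℂ)).natDegree.choose i ≤ 2 ^ m :=
      (Nat.choose_le_two_pow _ _).trans
        (Nat.pow_le_pow_right (by norm_num) (natDegree_map_le.trans hdeg))
    exact_mod_cast this
  have h4 : |(A.coeff i : ℝ)| = ‖(A.map (Int.castRingHom ℂ)).coeff i‖ := by simp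
  rw [h4, mul_assoc]
  exact h1.trans (mul_le_mul h3 h2 (mahlerMeasure_nonneg _) (by positivity))

theorem abs_det_le_of_entry_le {n : Type*} [Fintype n] [DecidableEq n] (A : Matrix n n ℝ)
    (r c : n → ℝ) (h : ∀ i j, |A i j| ≤ r i * c j) :
    |A.det| ≤ (Fintype.card n).factorial * ((∏ i, r i) * ∏ j, c j) := by
  rw [Matrix.det_apply]
  refine (Finset.abs_sum_le_sum_abs _ _).trans ?_
  refine (Finset.sum_le_card_nsmul _ _ ((∏ i, r i) * ∏ j, c j) fun σ _ => ?_).trans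
    (by simp [Fintype.card_perm])
  have : |Equiv.Perm.sign σ • ∏ i, A (σ i) i| = ∏ i, |A (σ i) i| := by
    rcases Int.units_eq_one_or (Equiv.Perm.sign σ) with h | h <;>
      simp [h, Finset.abs_prod]
  rw [this]
  refine (Finset.prod_le_prod (fun _ _ => abs_nonneg _) fun i _ => h (σ i) i).trans ?_
  rw [Finset.prod_mul_distrib, Equiv.prod_comp σ r]

theorem sum_pow_mul_sylvester_castAdd {R : Type*} [CommRing R] (f g : R[X]) {m n : ℕ}
    (hg : g.natDegree ≤ n) (x : R) (j : Fin m) :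
    ∑ i : Fin (m + n), x ^ (i : ℕ) * sylvester f g m n i (j.castAdd n) = x ^ (j : ℕ) * g.eval x := by
  have hdeg : (X ^ (j : ℕ) * g).natDegree < m + n := by
    have h1 := natDegree_mul_le (p := X ^ (j : ℕ)) (q := g)
    have h2 := natDegree_X_pow_le (R := R) (j : ℕ)
    have := j.2
    lia
  have := eval_eq_sum_range' hdeg x
  rw [eval_mul, eval_pow, eval_X] at this
  rw [this, Finset.sum_range]
  refine Finset.sum_congr rfl fun i _ => ?_
  rw [mul_comm, coeff_X_pow_mul', sylvester, Matrix.of_apply, Fin.addCases_left]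
  congr 1
  by_cases h1 : (j : ℕ) ≤ i
  · by_cases h2 : (i : ℕ) ≤ j + n
    · simp [h1, h2]
    · simp only [Set.mem_Icc, h1, h2, and_false, if_false, if_true]
      exact (coeff_eq_zero_of_natDegree_lt (by lia)).symm
  · simp [h1]

theorem sum_pow_mul_sylvester_natAdd {R : Type*} [CommRing R] (f g : R[X]) {m n : ℕ}
    (hf : f.natDegree ≤ m) (x : R) (j : Fin n) :
    ∑ i : Fin (m + n), x ^ (i : ℕ) * sylvester f g m n i (j.natAdd m) = x ^ (j : ℕ) * f.eval x := by
  rw [← sum_pow_mul_sylvester_castAdd g f hf x j, sylvester_comm f g m n,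
    ← Equiv.sum_comp (finCongr (add_comm n m))]
  refine Finset.sum_congr rfl fun i _ => ?_
  simp

theorem abs_resultant_le {f g : ℝ[X]} {m n : ℕ} (hmn : 0 < m + n) (hf : f.natDegree ≤ m)
    (hg : g.natDegree ≤ n) {a b x δ C : ℝ} (ha : 1 ≤ a) (hb : 1 ≤ b)
    (hfa : ∀ i, |f.coeff i| ≤ a) (hgb : ∀ i, |g.coeff i| ≤ b)
    (hfx : |f.eval x| ≤ δ) (hgx : |g.eval x| ≤ δ) (hC : ∀ j < m + n, |x| ^ j ≤ C) :
    |f.resultant g m n| ≤ (m + n).factorial * (C * δ * (b ^ m * a ^ n)) := by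
  have hδ : 0 ≤ δ := (abs_nonneg _).trans hfx
  have hC0 : 0 ≤ C := (by positivity : (0 : ℝ) ≤ |x| ^ 0).trans (hC 0 hmn)
  let z : Fin (m + n) := ⟨0, hmn⟩
  let c : Fin (m + n) → ℝ := Fin.addCases (fun _ => b) (fun _ => a)
  let M := sylvester f g m n
  have hM : (M.updateRow z (∑ i : Fin (m + n), x ^ (i : ℕ) • M i)).det = f.resultant g m n := by
    rw [Matrix.det_updateRow_sum]
    simp [z, M, resultant]
  have key := abs_det_le_of_entry_le
    (M.updateRow z (∑ i : Fin (m + n), x ^ (i : ℕ) • M i))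
    (Function.update 1 z (C * δ)) c (by
      intro i j
      by_cases hi : i = z
      · subst hi
        rw [Matrix.updateRow_self, Function.update_self, Finset.sum_apply]
        simp only [Pi.smul_apply, smul_eq_mul]
        induction j using Fin.addCases with
        | left j =>
          rw [sum_pow_mul_sylvester_castAdd f g hg, abs_mul, abs_pow]
          simp only [c, Fin.addCases_left]
          have := mul_le_mul (hC j (by lia)) hgx (abs_nonneg _) hC0
          exact this.trans (le_mul_of_one_le_right (by positivity) hb)
        | right j =>
          rw [sum_pow_mul_sylvester_natAdd f g hf, abs_mul, abs_pow]
          simp only [c, Fin.addCases_right]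
          have := mul_le_mul (hC j (by lia)) hfx (abs_nonneg _) hC0
          exact this.trans (le_mul_of_one_le_right (by positivity) ha)
      · rw [Matrix.updateRow_ne hi, Function.update_of_ne hi, Pi.one_apply, one_mul]
        induction j using Fin.addCases with
        | left j =>
          simp only [M, c, sylvester, Matrix.of_apply, Fin.addCases_left]
          split_ifs
          · exact hgb _
          · simpa using zero_le_one.trans hb
        | right j =>
          simp only [M, c, sylvester, Matrix.of_apply, Fin.addCases_right]
          split_ifs
          · exact hfa _
          · simpa using zero_le_one.trans ha)
  rw [hM, Fintype.card_fin] at key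
  refine key.trans_eq ?_
  rw [Finset.prod_update_of_mem (Finset.mem_univ z), Fin.prod_univ_add]
  simp [c]

theorem resultant_ne_zero_of_not_dvd {P Q : ℤ[X]} (hP : Irreducible P) (hprim : P.IsPrimitive)
    (hPQ : ¬ P ∣ Q) : P.resultant Q ≠ 0 := by
  have h1 := (IsPrimitive.Int.irreducible_iff_irreducible_map_cast hprim).1 hP
  rw [IsPrimitive.Int.dvd_iff_map_cast_dvd_map_cast _ _ hprim] at hPQ
  have h2 := resultant_ne_zero _ _ ((h1.coprime_iff_not_dvd).2 hPQ)
  rw [natDegree_map_eq_of_injective (Int.castRingHom ℚ).injective_int,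
    natDegree_map_eq_of_injective (Int.castRingHom ℚ).injective_int, resultant_map_map] at h2
  exact fun h => h2 (by rw [h, map_zero])

theorem aeval_eq_eval_map_real (P : ℤ[X]) (ξ : ℝ) :
    aeval ξ P = (P.map (Int.castRingHom ℝ)).eval ξ := by
  rw [aeval_def, eval₂_eq_eval_map]
  rfl

/-- An irreducible primitive integer polynomial `P` and an integer polynomial `Q` not divisible by
it cannot both be very small at the same point. -/
theorem one_le_of_irreducible_of_not_dvd (m : ℕ) (ξ : ℝ) : ∃ K : ℝ, 0 < K ∧
    ∀ (P Q : ℤ[X]) (h H δ : ℝ), Irreducible P → P.IsPrimitive → ¬ P ∣ Q → 1 ≤ P.natDegree →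
      P.natDegree ≤ m → Q.natDegree ≤ m → 1 ≤ h → 1 ≤ H → polyHeight P ≤ h → polyHeight Q ≤ H →
      |aeval ξ P| ≤ δ → |aeval ξ Q| ≤ δ → 1 ≤ K * δ * (H ^ m * h ^ m) := by
  refine ⟨(2 * m).factorial * max 1 |ξ| ^ (2 * m), by positivity, ?_⟩
  intro P Q h H δ hirr hprim hdvd hP1 hPm hQm hh hH hPh hQH hPδ hQδ
  have hδ : 0 ≤ δ := (abs_nonneg _).trans hPδ
  have hres : (1 : ℝ) ≤ |((P.resultant Q : ℤ) : ℝ)| := by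
    exact_mod_cast Int.one_le_abs (resultant_ne_zero_of_not_dvd hirr hprim hdvd)
  have hmap : ((P.resultant Q : ℤ) : ℝ) = (P.map (Int.castRingHom ℝ)).resultant
      (Q.map (Int.castRingHom ℝ)) P.natDegree Q.natDegree := by
    rw [resultant_map_map]
    rfl
  rw [aeval_eq_eval_map_real] at hPδ hQδ
  have key := abs_resultant_le (f := P.map (Int.castRingHom ℝ)) (g := Q.map (Int.castRingHom ℝ))
    (by lia) natDegree_map_le natDegree_map_le hh hH
    (fun i => by simpa using (abs_coeff_le_polyHeight P i).trans hPh)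
    (fun i => by simpa using (abs_coeff_le_polyHeight Q i).trans hQH) hPδ hQδ
    (C := max 1 |ξ| ^ (2 * m)) (fun j hj =>
      (pow_le_pow_left₀ (abs_nonneg _) (le_max_right 1 _) j).trans
        (pow_le_pow_right₀ (le_max_left _ _) (by lia)))
  rw [← hmap] at key
  refine (hres.trans key).trans ?_
  rw [mul_assoc, mul_assoc, mul_assoc]
  have hfac : ((P.natDegree + Q.natDegree).factorial : ℝ) ≤ (2 * m).factorial := by
    exact_mod_cast Nat.factorial_le (by lia)
  gcongr

theorem aeval_ne_zero_of_transcendental {ξ : ℝ} (hξ : Transcendental ℚ ξ) {P : ℤ[X]}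
    (hP : P ≠ 0) : aeval ξ P ≠ 0 :=
  fun h => hP ((transcendental_iff.1 (hξ.restrictScalars (R := ℤ)
    (FaithfulSMul.algebraMap_injective ℤ ℚ))) P h)

/-- A finite exponent `w_n(ξ)` gives a polynomial lower bound. -/
theorem exists_lower_bound_of_wExp_lt_top {n : ℕ} {ξ : ℝ} (hξ : Transcendental ℚ ξ)
    (hw : wExp n ξ < ⊤) : ∃ v c : ℝ, 0 < v ∧ 0 < c ∧ ∀ (A : ℤ[X]) (h : ℝ), A ≠ 0 →
      A.natDegree ≤ n → polyHeight A ≤ h → c * h ^ (-v) ≤ |aeval ξ A| := by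
  obtain ⟨v₀, hv₀, -⟩ := EReal.lt_iff_exists_real_btwn.1 hw
  set v := max v₀ 1
  have hv : wExp n ξ < (v : EReal) := hv₀.trans_le (EReal.coe_le_coe_iff.2 (le_max_left _ _))
  have hv0 : 0 < v := zero_lt_one.trans_le (le_max_right _ _)
  set S := {P : ℤ[X] | P.natDegree ≤ n ∧ 0 < |aeval ξ P| ∧ |aeval ξ P| ≤ polyHeight P ^ (-v)}
  have hS : S.Finite := by
    by_contra hinf
    exact hv.not_ge (le_sSup ⟨v, rfl, hinf⟩)
  obtain ⟨P₀, hP₀, hmin⟩ := Set.exists_min_image (insert 1 S) (fun P => |aeval ξ P|)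
    (hS.insert 1) (Set.insert_nonempty _ _)
  have hc1 : |aeval ξ P₀| ≤ 1 := by simpa using hmin 1 (Set.mem_insert _ _)
  have hc0 : 0 < |aeval ξ P₀| := by
    rcases hP₀ with rfl | h
    · simp
    · exact h.2.1
  refine ⟨v, |aeval ξ P₀|, hv0, hc0, fun A h hA hdeg hh => ?_⟩
  have hA1 := one_le_polyHeight hA
  have hpos : 0 < h := by linarith
  by_cases hAS : A ∈ S
  · refine le_trans ?_ (hmin A (Set.mem_insert_of_mem _ hAS))
    exact mul_le_of_le_one_right hc0.le
      (Real.rpow_le_one_of_one_le_of_nonpos (hA1.trans hh) (by linarith))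
  · have : polyHeight A ^ (-v) < |aeval ξ A| := by
      by_contra hle
      exact hAS ⟨hdeg, abs_pos.2 (aeval_ne_zero_of_transcendental hξ hA), not_lt.1 hle⟩
    refine le_trans ?_ this.le
    refine (mul_le_of_le_one_left (by positivity) hc1).trans ?_
    exact Real.rpow_le_rpow_of_nonpos (by linarith) hh (by linarith)

theorem exists_small_of_wExp_eq_top {m : ℕ} {ξ : ℝ} (hw : wExp m ξ = ⊤) (W B : ℝ) :
    ∃ P : ℤ[X], P.natDegree ≤ m ∧ 0 < |aeval ξ P| ∧ B < polyHeight P ∧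
      |aeval ξ P| ≤ polyHeight P ^ (-W) := by
  have hlt : (W : EReal) < wExp m ξ := hw ▸ EReal.coe_lt_top W
  obtain ⟨_, ⟨w, rfl, hinf⟩, hWw⟩ := lt_sSup_iff.1 hlt
  obtain ⟨P, hP, hPB⟩ := hinf.exists_notMem_finite (finite_polyHeight_le m B)
  have hP0 : P ≠ 0 := by
    rintro rfl
    simpa using hP.2.1
  refine ⟨P, hP.1, hP.2.1, ?_, hP.2.2.trans ?_⟩
  · by_contra h
    exact hPB ⟨hP.1, not_lt.1 h⟩
  · exact Real.rpow_le_rpow_of_exponent_le (one_le_polyHeight hP0)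
      (neg_le_neg (EReal.coe_lt_coe_iff.1 hWw).le)

theorem whExp_le_of_wExp {m : ℕ} (hm : 1 ≤ m) {ξ : ℝ} (hξ : Transcendental ℚ ξ)
    (hU1 : wExp m ξ = ⊤) (hU2 : wExp (m - 1) ξ < ⊤) : whExp m ξ ≤ (m : EReal) := by
  refine sSup_le ?_
  rintro _ ⟨w, rfl, hw⟩
  rw [← EReal.coe_natCast, EReal.coe_le_coe_iff]
  by_contra! hwm
  have hm0 : (0 : ℝ) < m := by exact_mod_cast hm
  have hw0 : 0 < w := hm0.trans hwm
  obtain ⟨H₀, hH₀⟩ := eventually_atTop.1 hw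
  obtain ⟨v, c, hv, hc, hlow⟩ := exists_lower_bound_of_wExp_lt_top hξ hU2
  obtain ⟨K, hK, hres⟩ := one_le_of_irreducible_of_not_dvd m ξ
  obtain ⟨W, hW⟩ : ∃ W, 2 * v + 1 ≤ W ∧ w ≤ W ∧ (m + 1) * (w / (w - m)) ≤ W :=
    ⟨max (2 * v + 1) (max w _), le_max_left _ _, (le_max_left _ _).trans (le_max_right _ _),
      (le_max_right _ _).trans (le_max_right _ _)⟩
  obtain ⟨hW1, hW2, hW3⟩ := hW
  set L : ℝ := 2 ^ m * (m + 1)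
  obtain ⟨B, hB⟩ : ∃ B : ℝ, 1 ≤ B ∧ H₀ ≤ B ∧ c⁻¹ ≤ B ∧ (c * L ^ (-v) * (c * L ^ (-v)))⁻¹ ≤ B ∧
      2 * K ≤ B :=
    ⟨1 + |H₀| + |c⁻¹| + |(c * L ^ (-v) * (c * L ^ (-v)))⁻¹| + |2 * K|, by
      have h1 := le_abs_self H₀
      have h2 := le_abs_self c⁻¹
      have h3 := le_abs_self (c * L ^ (-v) * (c * L ^ (-v)))⁻¹
      have h4 := le_abs_self (2 * K)
      have := abs_nonneg H₀
      have := abs_nonneg c⁻¹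
      have := abs_nonneg (c * L ^ (-v) * (c * L ^ (-v)))⁻¹
      have := abs_nonneg (2 * K)
      refine ⟨?_, ?_, ?_, ?_, ?_⟩ <;> linarith⟩
  obtain ⟨hB1, hB2, hB3, hB4, hB5⟩ := hB
  obtain ⟨P₀, hP₀m, hP₀0, hP₀B, hP₀W⟩ := exists_small_of_wExp_eq_top hU1 W B
  set h := polyHeight P₀
  have hh1 : 1 < h := hB1.trans_lt hP₀B
  have hh0 : 0 < h := by linarith
  have hP₀ne : P₀ ≠ 0 := by
    rintro rfl
    simp at hP₀0
  set P := P₀.primPart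
  have hfac : P₀ = C P₀.content * P := P₀.eq_C_content_mul_primPart
  have hprim : P.IsPrimitive := P₀.isPrimitive_primPart
  have hPm : P.natDegree ≤ m := (natDegree_primPart P₀).trans_le hP₀m
  have hPne : P ≠ 0 := hprim.ne_zero
  have hcont : (1 : ℝ) ≤ |(P₀.content : ℝ)| := by
    exact_mod_cast Int.one_le_abs (content_eq_zero_iff.not.2 hP₀ne)
  have hPh : polyHeight P ≤ h := by
    rw [polyHeight_le_iff hh0.le]
    intro i
    refine le_trans ?_ (abs_coeff_le_polyHeight P₀ i)
    rw [hfac, coeff_C_mul, Int.cast_mul, abs_mul]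
    exact le_mul_of_one_le_left (abs_nonneg _) hcont
  have hPW : |aeval ξ P| ≤ h ^ (-W) := by
    refine le_trans ?_ hP₀W
    rw [hfac, map_mul, aeval_C, abs_mul]
    exact le_mul_of_one_le_left (abs_nonneg _) hcont
  have hPpos : 0 < |aeval ξ P| := abs_pos.2 (aeval_ne_zero_of_transcendental hξ hPne)
  have hPdeg : P.natDegree = m := by
    by_contra hne
    have h1 := (hlow P h hPne (by lia) hPh).trans hPW
    have h2 : h ^ (-W) ≤ h ^ (-v) * h⁻¹ := by
      rw [← Real.rpow_neg_one h, ← Real.rpow_add hh0]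
      exact Real.rpow_le_rpow_of_exponent_le hh1.le (by linarith)
    have h3 : c ≤ h⁻¹ := by
      refine le_of_mul_le_mul_right ((h1.trans h2).trans_eq (mul_comm _ _)) ?_
      positivity
    have := inv_anti₀ hc h3
    rw [inv_inv] at this
    linarith
  have hirr : Irreducible P := by
    refine irreducible_iff.2 ⟨fun hu => ?_, fun A A' hAA => ?_⟩
    · have := natDegree_eq_zero_of_isUnit hu
      lia
    by_contra! hcon
    have hunit : ∀ D : ℤ[X], D ∣ P → ¬ IsUnit D → 1 ≤ D.natDegree := by
      intro D hD hDu
      by_contra hlt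
      rw [eq_C_of_natDegree_eq_zero (by lia : D.natDegree = 0)] at hD hDu
      exact hDu ((hprim _ hD).map C)
    have hA := hunit A ⟨A', hAA⟩ hcon.1
    have hA' := hunit A' ⟨A, by rw [hAA, mul_comm]⟩ hcon.2
    have hAA0 : A * A' ≠ 0 := hAA ▸ hPne
    have hA0 := left_ne_zero_of_mul hAA0
    have hA'0 := right_ne_zero_of_mul hAA0
    have hdeg : A.natDegree + A'.natDegree = m := by
      rw [← natDegree_mul hA0 hA'0, ← hAA, hPdeg]
    have hL : L * polyHeight P ≤ L * h := by gcongr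
    have hLA : polyHeight A ≤ L * h := by
      refine le_trans ?_ hL
      have := polyHeight_left_le_of_mul hAA0 (m := m) (hAA ▸ hPm)
      rwa [← hAA] at this
    have hLA' : polyHeight A' ≤ L * h := by
      refine le_trans ?_ hL
      have := polyHeight_left_le_of_mul (mul_comm A A' ▸ hAA0) (m := m)
        (mul_comm A A' ▸ hAA ▸ hPm)
      rwa [mul_comm A' A, ← hAA] at this
    have hL0 : 0 < L := by positivity
    have h1 := hlow A _ hA0 (by lia) hLA
    have h2 := hlow A' _ hA'0 (by lia) hLA'
    have h3 := (mul_le_mul h1 h2 (by positivity) (abs_nonneg _))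
    rw [← abs_mul, ← map_mul, ← hAA, Real.mul_rpow hL0.le hh0.le] at h3
    have h4 : h ^ (-W) ≤ h ^ (-v) * h ^ (-v) * h⁻¹ := by
      rw [← Real.rpow_neg_one h, ← Real.rpow_add hh0, ← Real.rpow_add hh0]
      exact Real.rpow_le_rpow_of_exponent_le hh1.le (by linarith)
    have h5 : c * L ^ (-v) * (c * L ^ (-v)) ≤ h⁻¹ := by
      refine le_of_mul_le_mul_right (a := h ^ (-v) * h ^ (-v)) ?_ (by positivity)
      calc _ = c * (L ^ (-v) * h ^ (-v)) * (c * (L ^ (-v) * h ^ (-v))) := by ring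
        _ ≤ _ := (h3.trans hPW).trans h4
        _ = _ := mul_comm _ _
    have := inv_anti₀ (by positivity) h5
    rw [inv_inv] at this
    linarith
  set p := |aeval ξ P|
  set H := (p / 2) ^ (-w⁻¹)
  have hHw : H ^ (-w) = p / 2 := by
    rw [← Real.rpow_mul (by positivity), neg_mul_neg, inv_mul_cancel₀ hw0.ne', Real.rpow_one]
  have hH0 : 0 < H := by positivity
  have hHW : h ^ (W / w) ≤ H := by
    have : (h ^ (-W)) ^ (-w⁻¹) ≤ H :=
      Real.rpow_le_rpow_of_nonpos (by positivity) (by linarith)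
        (neg_nonpos.2 (inv_nonneg.2 hw0.le))
    rwa [← Real.rpow_mul hh0.le, neg_mul_neg, ← div_eq_mul_inv] at this
  have hhH : h ≤ H := by
    refine le_trans ?_ hHW
    exact Real.self_le_rpow_of_one_le hh1.le ((one_le_div hw0).2 hW2)
  obtain ⟨Q, hQm, hQH, hQ0, hQw⟩ := hH₀ H (by linarith)
  rw [hHw] at hQw
  have hPQ : ¬ P ∣ Q := by
    rintro ⟨R, rfl⟩
    have hPR : P * R ≠ 0 := by
      intro h0
      simp [h0] at hQ0
    have hR0 := right_ne_zero_of_mul hPR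
    rw [natDegree_mul hPne hR0] at hQm
    rw [eq_C_of_natDegree_eq_zero (by lia : R.natDegree = 0)] at hQw hR0
    rw [map_mul, aeval_C, abs_mul] at hQw
    have : (1 : ℝ) ≤ |algebraMap ℤ ℝ (R.coeff 0)| := by
      have h0 : R.coeff 0 ≠ 0 := fun h0 => hR0 (by rw [h0, C_0])
      have := Int.one_le_abs h0
      rw [eq_intCast]
      exact_mod_cast this
    have := le_mul_of_one_le_right hPpos.le this
    linarith
  have key := hres P Q h H p hirr hprim hPQ (by lia) hPm hQm hh1.le (by linarith) hPh hQH le_rfl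
    (by linarith)
  have hp : p = 2 * H ^ (-w) := by linarith
  have hwm' : 0 < w - m := by linarith
  have h1 : h ^ ((m : ℝ) + 1) ≤ H ^ (w - m) := by
    refine le_trans ?_ (Real.rpow_le_rpow (by positivity) hHW hwm'.le)
    rw [← Real.rpow_mul hh0.le]
    refine Real.rpow_le_rpow_of_exponent_le hh1.le ?_
    calc (m : ℝ) + 1 = (m + 1) * (w / (w - m)) / w * (w - m) := by field_simp
      _ ≤ W / w * (w - m) := by gcongr
  have h2 : H ^ (-w) * H ^ m * H ^ (w - m) = 1 := by
    rw [← Real.rpow_natCast, ← Real.rpow_add hH0, ← Real.rpow_add hH0]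
    simp
  have h3 : H ^ (w - m) ≤ 2 * K * h ^ m := by
    have := mul_le_mul_of_nonneg_right key (by positivity : 0 ≤ H ^ (w - m))
    rw [one_mul] at this
    refine this.trans_eq ?_
    rw [hp]
    linear_combination (2 * K * h ^ m) * h2
  rw [Real.rpow_add_one hh0.ne', Real.rpow_natCast] at h1
  have h4 : h ≤ 2 * K := by
    refine le_of_mul_le_mul_right ?_ (by positivity : 0 < h ^ m)
    linarith
  linarith

/-- Dirichlet's pigeonhole argument for the values of integer polynomials at `ξ`. -/
theorem exists_polynomial_small_value (m : ℕ) (hm : 1 ≤ m) (ξ : ℝ) : ∃ S : ℝ, 0 < S ∧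
    ∀ N : ℕ, 1 ≤ N → ∃ P : ℤ[X], P ≠ 0 ∧ P.natDegree ≤ m ∧ polyHeight P ≤ N ∧
      |aeval ξ P| * N ^ m ≤ S := by
  set T := ∑ i : Fin (m + 1), |ξ| ^ (i : ℕ)
  have hT : 0 < T := Finset.sum_pos' (fun i _ => by positivity) ⟨0, Finset.mem_univ _, by simp⟩
  refine ⟨2 * T, by positivity, fun N hN => ?_⟩
  have hN0 : (0 : ℝ) < N := by exact_mod_cast hN
  let f : (Fin (m + 1) → Fin (N + 1)) → ℝ := fun a => ∑ i, ((a i : ℕ) : ℝ) * ξ ^ (i : ℕ)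
  have hf : ∀ a, |f a| ≤ N * T := by
    intro a
    refine (Finset.abs_sum_le_sum_abs _ _).trans ?_
    rw [Finset.mul_sum]
    refine Finset.sum_le_sum fun i _ => ?_
    rw [abs_mul, abs_pow, Nat.abs_cast]
    gcongr
    exact_mod_cast Nat.le_of_lt_succ (a i).2
  let g : (Fin (m + 1) → Fin (N + 1)) → ℝ := fun a => (f a + N * T) * (N ^ m / (2 * T))
  have hg0 : ∀ a, 0 ≤ g a := fun a =>
    mul_nonneg (by linarith [neg_le_of_abs_le (hf a)]) (by positivity)
  have hg1 : ∀ a, g a ≤ (N ^ (m + 1) : ℕ) := by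
    intro a
    calc g a ≤ (N * T + N * T) * (N ^ m / (2 * T)) := by
          refine mul_le_mul_of_nonneg_right ?_ (by positivity)
          linarith [le_of_abs_le (hf a)]
      _ = _ := by
          push_cast
          field_simp
          ring
  have hcard : (Finset.range (N ^ (m + 1) + 1)).card <
      (Finset.univ : Finset (Fin (m + 1) → Fin (N + 1))).card := by
    rw [Finset.card_range, Finset.card_univ, Fintype.card_fun, Fintype.card_fin, Fintype.card_fin]
    have h1 : N ^ m + 1 ≤ (N + 1) ^ m := by
      simpa using Nat.pow_lt_pow_left (Nat.lt_succ_self N) (by lia : m ≠ 0)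
    rw [pow_succ, pow_succ]
    have := Nat.mul_le_mul_right (N + 1) h1
    nlinarith [Nat.zero_le (N ^ m)]
  obtain ⟨a, -, b, -, hab, hfl⟩ := Finset.exists_ne_map_eq_of_card_lt_of_maps_to hcard
    (f := fun a => ⌊g a⌋₊) (fun a _ => by
      rw [Finset.mem_coe, Finset.mem_range, Nat.lt_succ_iff]
      exact Nat.floor_le_of_le (hg1 a))
  have hlt : |g a - g b| ≤ 1 := by
    have h1 := Nat.floor_le (hg0 a)
    have h2 := Nat.floor_le (hg0 b)
    have h3 := Nat.lt_floor_add_one (g a)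
    have h4 := Nat.lt_floor_add_one (g b)
    rw [hfl] at h1 h3
    rw [abs_le]
    constructor <;> linarith
  let d : Fin (m + 1) → ℤ := fun i => (a i : ℕ) - (b i : ℕ)
  let P : ℤ[X] := ofFn (m + 1) d
  have hcoeff : ∀ i : Fin (m + 1), P.coeff i = d i := fun i => by
    simp only [P]
    rw [ofFn_coeff_eq_val_of_lt _ i.2]
  have hdeg : P.natDegree < m + 1 := ofFn_natDegree_lt (by lia) d
  have hval : aeval ξ P = f a - f b := by
    rw [aeval_eq_sum_range' hdeg, Finset.sum_range, ← Finset.sum_sub_distrib]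
    refine Finset.sum_congr rfl fun i _ => ?_
    rw [hcoeff, zsmul_eq_mul]
    simp only [d]
    push_cast
    ring
  refine ⟨P, fun h0 => hab ?_, by lia, ?_, ?_⟩
  · funext i
    have := hcoeff i
    rw [h0, coeff_zero] at this
    simp only [d] at this
    exact Fin.ext (by lia)
  · rw [polyHeight_le_iff hN0.le]
    intro i
    by_cases hi : i < m + 1
    · have := hcoeff ⟨i, hi⟩
      simp only [d] at this
      rw [this]
      have h1 := (a ⟨i, hi⟩).2
      have h2 := (b ⟨i, hi⟩).2
      have : |((a ⟨i, hi⟩ : ℕ) : ℤ) - (b ⟨i, hi⟩ : ℕ)| ≤ N := by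
        rw [abs_le]
        constructor <;> omega
      exact_mod_cast this
    · rw [coeff_eq_zero_of_natDegree_lt (by lia)]
      simp
  · have : g a - g b = (f a - f b) * N ^ m / (2 * T) := by
      simp only [g]
      ring
    rwa [this, abs_div, abs_mul, abs_of_pos (by positivity : (0 : ℝ) < 2 * T),
      abs_of_pos (by positivity : (0 : ℝ) < N ^ m), div_le_one (by positivity), ← hval] at hlt

theorem le_whExp {m : ℕ} (hm : 1 ≤ m) {ξ : ℝ} (hξ : Transcendental ℚ ξ) :
    (m : EReal) ≤ whExp m ξ := by
  refine EReal.ge_of_forall_gt_iff_ge.1 fun w hw => le_sSup ⟨w, rfl, ?_⟩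
  rw [← EReal.coe_natCast, EReal.coe_lt_coe_iff] at hw
  obtain ⟨S, hS, hdir⟩ := exists_polynomial_small_value m hm ξ
  have hbig := (tendsto_rpow_atTop (sub_pos.2 hw)).eventually_ge_atTop (2 ^ m * S)
  filter_upwards [hbig, eventually_ge_atTop 1] with H hH hH1
  have hH0 : 0 < H := by linarith
  have hN1 : 1 ≤ ⌊H⌋₊ := Nat.one_le_floor_iff _ |>.2 hH1
  obtain ⟨P, hP0, hPm, hPN, hPS⟩ := hdir ⌊H⌋₊ hN1
  refine ⟨P, hPm, hPN.trans (Nat.floor_le hH0.le),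
    abs_pos.2 (aeval_ne_zero_of_transcendental hξ hP0), ?_⟩
  have hN2 : H ≤ 2 * (⌊H⌋₊ : ℝ) := by
    have h1 := Nat.lt_floor_add_one H
    have h2 : (1 : ℝ) ≤ (⌊H⌋₊ : ℝ) := by exact_mod_cast hN1
    linarith
  have h1 : |aeval ξ P| * H ^ m ≤ H ^ ((m : ℝ) - w) := by
    calc |aeval ξ P| * H ^ m ≤ |aeval ξ P| * (2 * (⌊H⌋₊ : ℝ)) ^ m := by gcongr
      _ = 2 ^ m * (|aeval ξ P| * (⌊H⌋₊ : ℝ) ^ m) := by ring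
      _ ≤ 2 ^ m * S := by gcongr
      _ ≤ _ := hH
  rw [sub_eq_neg_add, Real.rpow_add hH0, Real.rpow_natCast] at h1
  exact le_of_mul_le_mul_right h1 (by positivity)

theorem stmt9 (m : ℕ) (hm : 1 ≤ m) (ξ : ℝ) (hξ : Transcendental ℚ ξ)
    (hU1 : wExp m ξ = ⊤) (hU2 : wExp (m - 1) ξ < ⊤) :
    whExp m ξ = (m : EReal) := by
  exact le_antisymm (whExp_le_of_wExp hm hξ hU1 hU2) (le_whExp hm hξ)
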